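/- Let π: P → H be a surjective map of Hopf algebras over a field k, B := Pᴴ, and let Y be a left P-module, left P-comodule, right H-comodule and right B-module with all structures pairwise compatible. Then the left coinvariant subspace ᴾY := {y ∈ Y : y₍₋₁₎⊗y₍₀₎ = 1⊗y}, with the inherited right H-comodule structure and the new right B-action y ⋄ b := S(b₁)▷y◁b₂, is a crossed (H,B)-module. -/

import Mathlib

open TensorProduct CategoryTheory

noncomputable section

/- STATEMENT 10: the left coinvariants of a (P,P,H,B)-Hopf module, with the
twisted B-action, form a crossed (H,B)-module. -/

section Props
variable {k : Type} [Field k] {H : Type} [Ring H] [HopfAlgebra k H]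
variable {A : Type} [Ring A] [Algebra k A]
variable {V : Type} [AddCommGroup V] [Module k V]

/-- `ρ : V → V ⊗ H` is a right `H`-comodule structure. -/
def IsRightCoaction (ρ : V →ₗ[k] V ⊗[k] H) : Prop :=
  (∀ v, (TensorProduct.rid k V)
      ((LinearMap.lTensor V (Coalgebra.counit (R := k) (A := H))) (ρ v)) = v) ∧
  (∀ v, (LinearMap.rTensor H ρ) (ρ v) =
    (TensorProduct.assoc k V H H).symm
      ((LinearMap.lTensor V (Coalgebra.comul (R := k) (A := H))) (ρ v)))

/-- `lam : V → H ⊗ V` is a left `H`-comodule structure. -/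
def IsLeftCoaction (lam : V →ₗ[k] H ⊗[k] V) : Prop :=
  (∀ v, (TensorProduct.lid k V)
      ((LinearMap.rTensor V (Coalgebra.counit (R := k) (A := H))) (lam v)) = v) ∧
  (∀ v, (LinearMap.lTensor H lam) (lam v) =
    (TensorProduct.assoc k H H V)
      ((LinearMap.rTensor V (Coalgebra.comul (R := k) (A := H))) (lam v)))

/-- `act : V ⊗ A → V` is a right `A`-module structure on the `k`-vector space `V`. -/
def IsRightAction (act : V ⊗[k] A →ₗ[k] V) : Prop :=
  (∀ v, act (v ⊗ₜ (1 : A)) = v) ∧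
  (∀ (v : V) (a b : A), act (v ⊗ₜ (a * b)) = act (act (v ⊗ₜ a) ⊗ₜ b))

/-- `act : A ⊗ V → V` is a left `A`-module structure on the `k`-vector space `V`. -/
def IsLeftAction (act : A ⊗[k] V →ₗ[k] V) : Prop :=
  (∀ v, act ((1 : A) ⊗ₜ v) = v) ∧
  (∀ (a b : A) (v : V), act ((a * b) ⊗ₜ v) = act (a ⊗ₜ act (b ⊗ₜ v)))

end Props

variable {k : Type} [Field k]
variable {P : Type} [Ring P] [HopfAlgebra k P]
variable {H : Type} [Ring H] [HopfAlgebra k H]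

/-- The quantum homogeneous space `B = Pᴴ = {p : p₁ ⊗ π(p₂) = p ⊗ 1}`,
as a `k`-subspace of `P`. -/
def qhs (π : P →ₐc[k] H) : Submodule k P :=
  LinearMap.ker ((LinearMap.lTensor P (π : P →ₗ[k] H)) ∘ₗ
    (Coalgebra.comul (R := k) (A := P)) - (TensorProduct.mk k P H).flip 1)

lemma mem_qhs (π : P →ₐc[k] H) (p : P) :
    p ∈ qhs π ↔ (LinearMap.lTensor P (π : P →ₗ[k] H))
      (Coalgebra.comul (R := k) (A := P) p) = p ⊗ₜ (1 : H) := by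
  simp [qhs, sub_eq_zero, LinearMap.mem_ker]

lemma lTensor_pi_eq (π : P →ₐc[k] H) :
    (LinearMap.lTensor P (π : P →ₗ[k] H)) =
      (Algebra.TensorProduct.map (AlgHom.id k P) (π : P →ₐ[k] H)).toLinearMap :=
  TensorProduct.ext' fun p q => by
    simp [Algebra.TensorProduct.map_tmul]

/-- The quantum homogeneous space `B = Pᴴ` as a subalgebra of `P`. -/
def qhsAlg (π : P →ₐc[k] H) : Subalgebra k P where
  carrier := qhs π
  add_mem' ha hb := (qhs π).add_mem ha hb
  zero_mem' := (qhs π).zero_mem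
  one_mem' := by
    rw [SetLike.mem_coe, mem_qhs, Bialgebra.comul_one, Algebra.TensorProduct.one_def]
    simp
  mul_mem' := by
    intro a b ha hb
    rw [SetLike.mem_coe, mem_qhs] at ha hb ⊢
    rw [lTensor_pi_eq] at ha hb ⊢
    simp only [AlgHom.toLinearMap_apply] at ha hb ⊢
    have hc := map_mul (Bialgebra.comulAlgHom k P) a b
    simp only [Bialgebra.comulAlgHom_apply] at hc
    rw [hc, map_mul, ha, hb, Algebra.TensorProduct.tmul_mul_tmul, one_mul]
  algebraMap_mem' := by
    intro r
    rw [Algebra.algebraMap_eq_smul_one]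
    exact (qhs π).smul_mem r (by
      rw [mem_qhs, Bialgebra.comul_one, Algebra.TensorProduct.one_def]
      simp)

/-- The inclusion `B → P` as a `k`-linear map. -/
def qhsIncl (π : P →ₐc[k] H) : (qhsAlg π) →ₗ[k] P := (qhsAlg π).val.toLinearMap

/-- `coactB : B → P ⊗ B` is the restriction of the comultiplication of `P`
(such a map exists and is unique since `Δ(B) ⊆ P ⊗ B`). -/
def IsRestrictedComul (π : P →ₐc[k] H)
    (coactB : (qhsAlg π) →ₗ[k] P ⊗[k] (qhsAlg π)) : Prop :=
  (LinearMap.lTensor P (qhsIncl π)) ∘ₗ coactB =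
    (Coalgebra.comul (R := k) (A := P)) ∘ₗ (qhsIncl π)

/-- The right `H`-coaction `p ↦ p₁ ⊗ π(p₂)` on `P`. -/
def piCoact (π : P →ₐc[k] H) : P →ₗ[k] P ⊗[k] H :=
  (LinearMap.lTensor P (π : P →ₗ[k] H)) ∘ₗ (Coalgebra.comul (R := k) (A := P))

/-- The map `a ↦ a₂ ⊗ π(S(a₁))` on `P`. -/
def adCoact₀ (π : P →ₐc[k] H) : P →ₗ[k] P ⊗[k] H :=
  (LinearMap.lTensor P ((π : P →ₗ[k] H) ∘ₗ (HopfAlgebra.antipode (R := k) (A := P)))) ∘ₗ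
    (TensorProduct.comm k P P).toLinearMap ∘ₗ
    (Coalgebra.comul (R := k) (A := P))

/-- The crossed `(H,B)`-module condition
`x₍₀₎ ◁ b ⊗ x₍₁₎ = (x ◁ b₂)₍₀₎ ⊗ π(b₁)(x ◁ b₂)₍₁₎` for a right `B`-module and
right `H`-comodule `X`, where `Δ(b) = b₁ ⊗ b₂ ∈ P ⊗ B` is given by `coactB`. -/
def IsCrossedPair (π : P →ₐc[k] H)
    (coactB : (qhsAlg π) →ₗ[k] P ⊗[k] (qhsAlg π))
    {X : Type} [AddCommGroup X] [Module k X]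
    (ract : X ⊗[k] (qhsAlg π) →ₗ[k] X) (ρ : X →ₗ[k] X ⊗[k] H) : Prop :=
  (LinearMap.rTensor H ract) ∘ₗ
      (TensorProduct.assoc k X (qhsAlg π) H).symm.toLinearMap ∘ₗ
      (LinearMap.lTensor X (TensorProduct.comm k H (qhsAlg π)).toLinearMap) ∘ₗ
      (TensorProduct.assoc k X H (qhsAlg π)).toLinearMap ∘ₗ
      (LinearMap.rTensor (qhsAlg π) ρ) =
  (LinearMap.lTensor X (LinearMap.mul' k H)) ∘ₗ
      (TensorProduct.leftComm k H X H).toLinearMap ∘ₗ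
      (TensorProduct.map (π : P →ₗ[k] H) (ρ ∘ₗ ract)) ∘ₗ
      (TensorProduct.leftComm k X P (qhsAlg π)).toLinearMap ∘ₗ
      (LinearMap.lTensor X coactB)

/-- A left `P`-module, left `P`-comodule, right `H`-comodule, right `B`-module
with all structures pairwise compatible, on a fixed `k`-vector space `Y`.
Here `coactB` is the restricted comultiplication `B → P ⊗ B`. -/
structure PPHBStr (π : P →ₐc[k] H)
    (coactB : (qhsAlg π) →ₗ[k] P ⊗[k] (qhsAlg π))
    (Y : Type) [AddCommGroup Y] [Module k Y] where
  lact : P ⊗[k] Y →ₗ[k] Y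
  ract : Y ⊗[k] (qhsAlg π) →ₗ[k] Y
  lam : Y →ₗ[k] P ⊗[k] Y
  ρ : Y →ₗ[k] Y ⊗[k] H
  lact_action : IsLeftAction lact
  ract_action : IsRightAction ract
  lam_coaction : IsLeftCoaction lam
  ρ_coaction : IsRightCoaction ρ
  acts_comm : ∀ (p : P) (y : Y) (b : qhsAlg π),
    ract (lact (p ⊗ₜ y) ⊗ₜ b) = lact (p ⊗ₜ ract (y ⊗ₜ b))
  coacts_comm : ∀ y, (LinearMap.rTensor H lam) (ρ y) =
    (TensorProduct.assoc k P Y H).symm ((LinearMap.lTensor P ρ) (lam y))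
  /-- `λ(p ▷ y) = p₁ y₍₋₁₎ ⊗ p₂ ▷ y₍₀₎` -/
  lact_lam : lam ∘ₗ lact =
    (TensorProduct.map (LinearMap.mul' k P) lact) ∘ₗ
      (tensorTensorTensorComm k P P P Y).toLinearMap ∘ₗ
      (TensorProduct.map (Coalgebra.comul (R := k) (A := P)) lam)
  /-- `ρ(p ▷ y) = p₁ ▷ y₍₀₎ ⊗ π(p₂) y₍₁₎` -/
  lact_ρ : ρ ∘ₗ lact =
    (TensorProduct.map lact (LinearMap.mul' k H)) ∘ₗ
      (tensorTensorTensorComm k P H Y H).toLinearMap ∘ₗ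
      (TensorProduct.map (piCoact π) ρ)
  /-- `λ(y ◁ b) = y₍₋₁₎ b₁ ⊗ y₍₀₎ ◁ b₂` -/
  ract_lam : lam ∘ₗ ract =
    (TensorProduct.map (LinearMap.mul' k P) ract) ∘ₗ
      (tensorTensorTensorComm k P Y P (qhsAlg π)).toLinearMap ∘ₗ
      (TensorProduct.map lam coactB)
  /-- `ρ(y ◁ b) = y₍₀₎ ◁ b ⊗ y₍₁₎` (`B` carries the trivial `H`-coaction) -/
  ract_ρ : ρ ∘ₗ ract =
    (LinearMap.rTensor H ract) ∘ₗ
      (TensorProduct.assoc k Y (qhsAlg π) H).symm.toLinearMap ∘ₗ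
      (LinearMap.lTensor Y (TensorProduct.comm k H (qhsAlg π)).toLinearMap) ∘ₗ
      (TensorProduct.assoc k Y H (qhsAlg π)).toLinearMap ∘ₗ
      (LinearMap.rTensor (qhsAlg π) ρ)

/-- The coinvariants `ᴾY = {y : y₍₋₁₎ ⊗ y₍₀₎ = 1 ⊗ y}` of a left `P`-coaction. -/
def leftCoinv {Y : Type} [AddCommGroup Y] [Module k Y]
    (lam : Y →ₗ[k] P ⊗[k] Y) : Submodule k Y :=
  LinearMap.ker (lam - (TensorProduct.mk k P Y) 1)

/-- The twisted right `B`-action `y ⋄ b = S(b₁) ▷ y ◁ b₂` on a left `P`-module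
right `B`-module `Y` (where `Δ(b) = b₁ ⊗ b₂ ∈ P ⊗ B` is given by `coactB`). -/
def twistRact (π : P →ₐc[k] H) (coactB : (qhsAlg π) →ₗ[k] P ⊗[k] (qhsAlg π))
    {Y : Type} [AddCommGroup Y] [Module k Y]
    (lact : P ⊗[k] Y →ₗ[k] Y) (ract : Y ⊗[k] (qhsAlg π) →ₗ[k] Y) :
    Y ⊗[k] (qhsAlg π) →ₗ[k] Y :=
  lact ∘ₗ
    (TensorProduct.map (HopfAlgebra.antipode (R := k) (A := P)) ract) ∘ₗ
    (TensorProduct.leftComm k Y P (qhsAlg π)).toLinearMap ∘ₗ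
    (LinearMap.lTensor Y coactB)

open WithConv

lemma antipode_comp_convMul {A : Type} [Ring A] [Algebra k A] (f : P →ₐ[k] A) :
    toConv (f.toLinearMap ∘ₗ HopfAlgebra.antipode k (A := P)) * toConv f.toLinearMap = 1 := by
  have h := LinearMap.algHom_comp_convMul_distrib f
    (toConv (HopfAlgebra.antipode k (A := P))) (toConv LinearMap.id)
  rw [LinearMap.antipode_mul_id] at h
  refine WithConv.ext (h.symm.trans ?_)
  ext p
  simp

lemma convMul_antipode_comp {A : Type} [Ring A] [Algebra k A] (f : P →ₐ[k] A) :
    toConv f.toLinearMap * toConv (f.toLinearMap ∘ₗ HopfAlgebra.antipode k (A := P)) = 1 := by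
  have h := LinearMap.algHom_comp_convMul_distrib f
    (toConv LinearMap.id) (toConv (HopfAlgebra.antipode k (A := P)))
  rw [LinearMap.id_mul_antipode] at h
  refine WithConv.ext (h.symm.trans ?_)
  ext p
  simp

lemma includeLeft_convMul_includeRight :
    toConv (Algebra.TensorProduct.includeLeft : P →ₐ[k] P ⊗[k] P).toLinearMap *
      toConv (Algebra.TensorProduct.includeRight : P →ₐ[k] P ⊗[k] P).toLinearMap =
    toConv (Bialgebra.comulAlgHom k P).toLinearMap := by
  ext p
  rw [(Coalgebra.Repr.arbitrary k p).convMul_apply]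
  simp [(Coalgebra.Repr.arbitrary k p).eq]

/-- `Δ(S(p₁)) (p₂ ⊗ 1) = 1 ⊗ S(p)`. -/
lemma comul_antipode_mul_includeLeft (p : P) :
    LinearMap.mul' k (P ⊗[k] P) (TensorProduct.map
      (Coalgebra.comul ∘ₗ HopfAlgebra.antipode k (A := P))
      (Algebra.TensorProduct.includeLeft : P →ₐ[k] P ⊗[k] P).toLinearMap
      (Coalgebra.comul (R := k) p)) = 1 ⊗ₜ HopfAlgebra.antipode k p := by
  have h := antipode_comp_convMul (Bialgebra.comulAlgHom k P)
  rw [← includeLeft_convMul_includeRight, ← mul_assoc] at h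
  have h' := left_inv_eq_right_inv h (convMul_antipode_comp _)
  exact congr($(congrArg WithConv.ofConv h') p)

/-- `(1 ⊗ p₁) Δ(S(p₂)) = S(p) ⊗ 1`. -/
lemma includeRight_mul_comul_antipode (p : P) :
    LinearMap.mul' k (P ⊗[k] P) (TensorProduct.map
      (Algebra.TensorProduct.includeRight : P →ₐ[k] P ⊗[k] P).toLinearMap
      (Coalgebra.comul ∘ₗ HopfAlgebra.antipode k (A := P))
      (Coalgebra.comul (R := k) p)) = HopfAlgebra.antipode k p ⊗ₜ 1 := by
  have h := convMul_antipode_comp (Bialgebra.comulAlgHom k P)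
  rw [← includeLeft_convMul_includeRight, mul_assoc] at h
  have h' := left_inv_eq_right_inv (antipode_comp_convMul _) h
  exact congr($(congrArg WithConv.ofConv h'.symm) p)

section RestrictedComul

variable {π : P →ₐc[k] H} {coactB : (qhsAlg π) →ₗ[k] P ⊗[k] (qhsAlg π)}

lemma qhsIncl_injective (π : P →ₐc[k] H) : Function.Injective (qhsIncl π) :=
  Subtype.val_injective

lemma IsRestrictedComul.apply (hco : IsRestrictedComul π coactB) (b : qhsAlg π) :
    LinearMap.lTensor P (qhsIncl π) (coactB b) = Coalgebra.comul (R := k) (b : P) :=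
  congr($hco b)

lemma IsRestrictedComul.map_one (hco : IsRestrictedComul π coactB) : coactB 1 = 1 := by
  apply Module.Flat.lTensor_preserves_injective_linearMap (M := P) _ (qhsIncl_injective π)
  rw [hco.apply]
  simp [Algebra.TensorProduct.one_def, qhsIncl]

lemma IsRestrictedComul.map_mul (hco : IsRestrictedComul π coactB) (a b : qhsAlg π) :
    coactB (a * b) = coactB a * coactB b := by
  apply Module.Flat.lTensor_preserves_injective_linearMap (M := P) _ (qhsIncl_injective π)
  have h (s t : P ⊗[k] qhsAlg π) : LinearMap.lTensor P (qhsIncl π) (s * t) =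
      LinearMap.lTensor P (qhsIncl π) s * LinearMap.lTensor P (qhsIncl π) t :=
    _root_.map_mul (Algebra.TensorProduct.map (AlgHom.id k P) (qhsAlg π).val) s t
  rw [h, hco.apply, hco.apply, hco.apply]
  simp

lemma IsRestrictedComul.coassoc (hco : IsRestrictedComul π coactB) (b : qhsAlg π) :
    LinearMap.lTensor P coactB (coactB b) =
      TensorProduct.assoc k P P (qhsAlg π)
        (LinearMap.rTensor (qhsAlg π) (Coalgebra.comul (R := k)) (coactB b)) := by
  apply Module.Flat.lTensor_preserves_injective_linearMap (M := P) _
    (Module.Flat.lTensor_preserves_injective_linearMap (M := P) _ (qhsIncl_injective π))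
  have h₁ : LinearMap.lTensor P (LinearMap.lTensor P (qhsIncl π)) ∘ₗ LinearMap.lTensor P coactB =
      LinearMap.lTensor P (Coalgebra.comul (R := k)) ∘ₗ LinearMap.lTensor P (qhsIncl π) := by
    rw [← LinearMap.lTensor_comp, hco, LinearMap.lTensor_comp]
  have h₂ : LinearMap.lTensor P (LinearMap.lTensor P (qhsIncl π)) ∘ₗ
      (TensorProduct.assoc k P P (qhsAlg π)).toLinearMap ∘ₗ
        LinearMap.rTensor (qhsAlg π) (Coalgebra.comul (R := k)) =
      (TensorProduct.assoc k P P P).toLinearMap ∘ₗ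
        LinearMap.rTensor P (Coalgebra.comul (R := k)) ∘ₗ LinearMap.lTensor P (qhsIncl π) := by
    refine TensorProduct.ext' fun p c => ?_
    simp only [LinearMap.comp_apply, LinearMap.rTensor_tmul, LinearMap.lTensor_tmul]
    induction Coalgebra.comul (R := k) p with
    | zero => simp
    | tmul x y => simp
    | add x y hx hy => simp only [TensorProduct.add_tmul, _root_.map_add, hx, hy]
  refine congr($h₁ (coactB b)).trans (Eq.trans ?_ congr($h₂ (coactB b)).symm)
  simp only [LinearMap.comp_apply, hco.apply, LinearEquiv.coe_coe, Coalgebra.coassoc_apply]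

end RestrictedComul

/-- The map `p ⊗ b ↦ S(p) ▷ y ◁ b`, linearly in `y`. -/
def antipodeSandwich (π : P →ₐc[k] H) {Y : Type} [AddCommGroup Y] [Module k Y]
    (lact : P ⊗[k] Y →ₗ[k] Y) (ract : Y ⊗[k] (qhsAlg π) →ₗ[k] Y) :
    Y →ₗ[k] P ⊗[k] (qhsAlg π) →ₗ[k] Y :=
  TensorProduct.curry (lact ∘ₗ
    (TensorProduct.map (HopfAlgebra.antipode (R := k) (A := P)) ract) ∘ₗ
    (TensorProduct.leftComm k Y P (qhsAlg π)).toLinearMap)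

section Sandwich

variable {π : P →ₐc[k] H} {Y : Type} [AddCommGroup Y] [Module k Y]
  (lact : P ⊗[k] Y →ₗ[k] Y) (ract : Y ⊗[k] (qhsAlg π) →ₗ[k] Y)

@[simp]
lemma antipodeSandwich_tmul (y : Y) (p : P) (b : qhsAlg π) :
    antipodeSandwich π lact ract y (p ⊗ₜ b) =
      lact (HopfAlgebra.antipode k p ⊗ₜ ract (y ⊗ₜ b)) := rfl

lemma twistRact_tmul (coactB : (qhsAlg π) →ₗ[k] P ⊗[k] (qhsAlg π)) (y : Y) (b : qhsAlg π) :
    twistRact π coactB lact ract (y ⊗ₜ b) = antipodeSandwich π lact ract y (coactB b) := rfl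

end Sandwich

namespace PPHBStr

variable {π : P →ₐc[k] H} {coactB : (qhsAlg π) →ₗ[k] P ⊗[k] (qhsAlg π)}
  {Y : Type} [AddCommGroup Y] [Module k Y] (D : PPHBStr π coactB Y)

lemma antipodeSandwich_mul (y : Y) (s t : P ⊗[k] (qhsAlg π)) :
    antipodeSandwich π D.lact D.ract y (s * t) =
      antipodeSandwich π D.lact D.ract (antipodeSandwich π D.lact D.ract y s) t := by
  induction s with
  | zero => simp
  | add s₁ s₂ h₁ h₂ => simp only [add_mul, map_add, h₁, h₂, LinearMap.add_apply]
  | tmul p b =>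
    induction t with
    | zero => simp
    | add t₁ t₂ h₁ h₂ => simp only [mul_add, map_add, h₁, h₂]
    | tmul q c =>
      simp only [Algebra.TensorProduct.tmul_mul_tmul, antipodeSandwich_tmul, D.acts_comm,
        HopfAlgebra.antipode_mul_antidistrib, D.ract_action.2, D.lact_action.2]

lemma isRightAction_twistRact (hco : IsRestrictedComul π coactB) :
    IsRightAction (twistRact π coactB D.lact D.ract) := by
  refine ⟨fun y => ?_, fun y a b => ?_⟩
  · rw [twistRact_tmul, hco.map_one, Algebra.TensorProduct.one_def, antipodeSandwich_tmul,
      D.ract_action.1, HopfAlgebra.antipode_one, D.lact_action.1]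
  · simp only [twistRact_tmul, hco.map_mul, D.antipodeSandwich_mul]

lemma lam_ract_of_mem {y : Y} (hy : D.lam y = 1 ⊗ₜ y) (b : qhsAlg π) :
    D.lam (D.ract (y ⊗ₜ b)) = LinearMap.lTensor P (TensorProduct.curry D.ract y) (coactB b) := by
  refine congr($D.ract_lam (y ⊗ₜ b)).trans ?_
  simp only [LinearMap.comp_apply, TensorProduct.map_tmul, hy]
  induction coactB b with
  | zero => simp
  | tmul p c => simp
  | add s t hs ht => simp only [TensorProduct.tmul_add, map_add, hs, ht]

lemma lam_antipodeSandwich (hco : IsRestrictedComul π coactB) {y : Y}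
    (hy : D.lam y = 1 ⊗ₜ y) (b : qhsAlg π) :
    D.lam (antipodeSandwich π D.lact D.ract y (coactB b)) =
      1 ⊗ₜ antipodeSandwich π D.lact D.ract y (coactB b) := by
  let N : P ⊗[k] (P ⊗[k] qhsAlg π) →ₗ[k] P ⊗[k] Y :=
    (TensorProduct.map (LinearMap.mul' k P) D.lact) ∘ₗ
      (tensorTensorTensorComm k P P P Y).toLinearMap ∘ₗ
      (TensorProduct.map (Coalgebra.comul ∘ₗ HopfAlgebra.antipode k (A := P))
        (LinearMap.lTensor P (TensorProduct.curry D.ract y)))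
  have h₁ : D.lam ∘ₗ antipodeSandwich π D.lact D.ract y = N ∘ₗ LinearMap.lTensor P coactB := by
    refine TensorProduct.ext' fun p c => ?_
    refine congr($D.lact_lam (HopfAlgebra.antipode k p ⊗ₜ D.ract (y ⊗ₜ c))).trans ?_
    simp only [N, LinearMap.comp_apply, TensorProduct.map_tmul, D.lam_ract_of_mem hy,
      LinearMap.lTensor_tmul]
  have h₂ (t : P ⊗[k] P) (c : qhsAlg π) : N (TensorProduct.assoc k P P (qhsAlg π) (t ⊗ₜ c)) =
      LinearMap.lTensor P (D.lact ∘ₗ (TensorProduct.mk k P Y).flip (D.ract (y ⊗ₜ c)))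
        (LinearMap.mul' k (P ⊗[k] P) (TensorProduct.map
          (Coalgebra.comul ∘ₗ HopfAlgebra.antipode k (A := P))
          (Algebra.TensorProduct.includeLeft : P →ₐ[k] P ⊗[k] P).toLinearMap t)) := by
    induction t with
    | zero => simp
    | add t₁ t₂ h₁ h₂ => simp only [TensorProduct.add_tmul, map_add, h₁, h₂]
    | tmul p q =>
      simp only [N, LinearMap.comp_apply, TensorProduct.assoc_tmul, TensorProduct.map_tmul,
        LinearMap.lTensor_tmul, LinearMap.mul'_apply]
      induction Coalgebra.comul (R := k) (HopfAlgebra.antipode k p) with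
      | zero => simp
      | add u v hu hv => simp only [TensorProduct.add_tmul, map_add, add_mul, hu, hv]
      | tmul u v => simp
  have h₃ : N ∘ₗ (TensorProduct.assoc k P P (qhsAlg π)).toLinearMap ∘ₗ
      LinearMap.rTensor (qhsAlg π) (Coalgebra.comul (R := k)) =
      TensorProduct.mk k P Y 1 ∘ₗ antipodeSandwich π D.lact D.ract y := by
    refine TensorProduct.ext' fun p c => ?_
    refine (h₂ _ c).trans ?_
    rw [comul_antipode_mul_includeLeft]
    simp
  refine congr($h₁ (coactB b)).trans ?_
  rw [LinearMap.comp_apply, hco.coassoc]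
  exact congr($h₃ (coactB b))

lemma isCrossedPair_twistRact (hco : IsRestrictedComul π coactB) :
    IsCrossedPair π coactB (twistRact π coactB D.lact D.ract) D.ρ := by
  refine TensorProduct.ext' fun y b => ?_
  let Φ : (P ⊗[k] H) ⊗[k] (Y ⊗[k] H) →ₗ[k] Y ⊗[k] H :=
    (TensorProduct.map D.lact (LinearMap.mul' k H)) ∘ₗ
      (tensorTensorTensorComm k P H Y H).toLinearMap
  let N : P ⊗[k] (P ⊗[k] qhsAlg π) →ₗ[k] Y ⊗[k] H :=
    (LinearMap.lTensor Y (LinearMap.mul' k H)) ∘ₗ (TensorProduct.leftComm k H Y H).toLinearMap ∘ₗ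
      (TensorProduct.map (π : P →ₗ[k] H) (D.ρ ∘ₗ antipodeSandwich π D.lact D.ract y))
  have h_ract (c : qhsAlg π) : D.ρ (D.ract (y ⊗ₜ c)) =
      LinearMap.rTensor H ((TensorProduct.curry D.ract).flip c) (D.ρ y) := by
    refine congr($D.ract_ρ (y ⊗ₜ c)).trans ?_
    simp only [LinearMap.comp_apply, LinearMap.rTensor_tmul]
    induction D.ρ y with
    | zero => simp
    | tmul z h => simp
    | add s t hs ht => simp only [TensorProduct.add_tmul, map_add, hs, ht]
  have h_left : LinearMap.rTensor H (twistRact π coactB D.lact D.ract)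
      ((TensorProduct.assoc k Y (qhsAlg π) H).symm
        (LinearMap.lTensor Y (TensorProduct.comm k H (qhsAlg π)).toLinearMap
          (TensorProduct.assoc k Y H (qhsAlg π) (D.ρ y ⊗ₜ b)))) =
      LinearMap.rTensor H ((antipodeSandwich π D.lact D.ract).flip (coactB b)) (D.ρ y) := by
    induction D.ρ y with
    | zero => simp
    | tmul z h => simp [twistRact_tmul]
    | add s t hs ht => simp only [TensorProduct.add_tmul, map_add, hs, ht]
  have h_right (s : P ⊗[k] qhsAlg π) : LinearMap.lTensor Y (LinearMap.mul' k H)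
      (TensorProduct.leftComm k H Y H
        (TensorProduct.map (π : P →ₗ[k] H) (D.ρ ∘ₗ twistRact π coactB D.lact D.ract)
          (TensorProduct.leftComm k Y P (qhsAlg π) (y ⊗ₜ s)))) =
      N (LinearMap.lTensor P coactB s) := by
    induction s with
    | zero => simp
    | tmul p c => simp [N, twistRact_tmul]
    | add s t hs ht => simp only [TensorProduct.tmul_add, map_add, hs, ht]
  have h_N (t : P ⊗[k] P) (c : qhsAlg π) : N (TensorProduct.assoc k P P (qhsAlg π) (t ⊗ₜ c)) =
      Φ (LinearMap.lTensor P (π : P →ₗ[k] H)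
        (LinearMap.mul' k (P ⊗[k] P) (TensorProduct.map
          (Algebra.TensorProduct.includeRight : P →ₐ[k] P ⊗[k] P).toLinearMap
          (Coalgebra.comul ∘ₗ HopfAlgebra.antipode k (A := P)) t)) ⊗ₜ D.ρ (D.ract (y ⊗ₜ c))) := by
    induction t with
    | zero => simp
    | add t₁ t₂ h₁ h₂ => simp only [TensorProduct.add_tmul, map_add, h₁, h₂]
    | tmul p q =>
      have h_lact := congr($D.lact_ρ (HopfAlgebra.antipode k q ⊗ₜ D.ract (y ⊗ₜ c)))
      simp only [LinearMap.comp_apply, TensorProduct.map_tmul, piCoact] at h_lact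
      simp only [N, Φ, LinearMap.comp_apply, TensorProduct.assoc_tmul, TensorProduct.map_tmul,
        antipodeSandwich_tmul, LinearMap.mul'_apply, h_lact]
      generalize D.ρ (D.ract (y ⊗ₜ c)) = w
      induction Coalgebra.comul (R := k) (HopfAlgebra.antipode k q) with
      | zero => simp
      | add u v hu hv =>
        simp only [TensorProduct.add_tmul, TensorProduct.tmul_add, map_add, mul_add, hu, hv]
      | tmul u v =>
        induction w with
        | zero => simp
        | add w z hw hz => simp only [TensorProduct.tmul_add, map_add, hw, hz]
        | tmul w z => simp [mul_assoc]
  have h_sandwich (s : P ⊗[k] qhsAlg π) : N (TensorProduct.assoc k P P (qhsAlg π)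
      (LinearMap.rTensor (qhsAlg π) (Coalgebra.comul (R := k)) s)) =
      LinearMap.rTensor H ((antipodeSandwich π D.lact D.ract).flip s) (D.ρ y) := by
    induction s with
    | zero => simp
    | add s t hs ht => simp only [map_add, hs, ht, LinearMap.rTensor_add, LinearMap.add_apply]
    | tmul p c =>
      rw [LinearMap.rTensor_tmul, h_N, includeRight_mul_comul_antipode, h_ract]
      induction D.ρ y with
      | zero => simp
      | add s t hs ht => simp only [TensorProduct.tmul_add, map_add, hs, ht]
      | tmul z h => simp [Φ]
  refine h_left.trans (((h_right (coactB b)).trans ?_).symm)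
  rw [hco.coassoc, h_sandwich]

lemma rTensor_sub_ρ_eq_zero {y : Y} (hy : D.lam y = 1 ⊗ₜ y) :
    LinearMap.rTensor H (D.lam - TensorProduct.mk k P Y 1) (D.ρ y) = 0 := by
  have h_sub : LinearMap.rTensor H (D.lam - TensorProduct.mk k P Y 1) (D.ρ y) =
      LinearMap.rTensor H D.lam (D.ρ y) - LinearMap.rTensor H (TensorProduct.mk k P Y 1) (D.ρ y) :=
    congr($(LinearMap.rTensor_sub (Q := H) D.lam (TensorProduct.mk k P Y 1)) (D.ρ y))
  rw [h_sub, sub_eq_zero, D.coacts_comm, hy, LinearMap.lTensor_tmul]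
  induction D.ρ y with
  | zero => simp
  | tmul z h => simp
  | add s t hs ht => simp only [TensorProduct.tmul_add, map_add, hs, ht]

end PPHBStr

lemma mem_leftCoinv {Y : Type} [AddCommGroup Y] [Module k Y] {lam : Y →ₗ[k] P ⊗[k] Y} {y : Y} :
    y ∈ leftCoinv lam ↔ lam y = 1 ⊗ₜ y := by
  simp [leftCoinv, sub_eq_zero]

section Restrict

variable {X Y : Type} [AddCommGroup X] [Module k X] [AddCommGroup Y] [Module k Y]
  {ι : X →ₗ[k] Y}

lemma IsRightAction.of_injective {A : Type} [Ring A] [Algebra k A] (hι : Function.Injective ι)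
    {actX : X ⊗[k] A →ₗ[k] X} {actY : Y ⊗[k] A →ₗ[k] Y}
    (hact : ∀ x a, ι (actX (x ⊗ₜ a)) = actY (ι x ⊗ₜ a)) (h : IsRightAction actY) :
    IsRightAction actX :=
  ⟨fun v => hι (by rw [hact, h.1]), fun v a b => hι (by simp only [hact, h.2])⟩

lemma IsRightCoaction.of_injective (hι : Function.Injective ι)
    {ρX : X →ₗ[k] X ⊗[k] H} {ρY : Y →ₗ[k] Y ⊗[k] H}
    (hρ : LinearMap.rTensor H ι ∘ₗ ρX = ρY ∘ₗ ι) (h : IsRightCoaction ρY) :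
    IsRightCoaction ρX := by
  refine ⟨fun v => hι ?_, fun v => ?_⟩
  · have h_nat : ι ∘ₗ (TensorProduct.rid k X).toLinearMap ∘ₗ
        LinearMap.lTensor X (Coalgebra.counit (R := k) (A := H)) =
        (TensorProduct.rid k Y).toLinearMap ∘ₗ
          LinearMap.lTensor Y (Coalgebra.counit (R := k) (A := H)) ∘ₗ LinearMap.rTensor H ι :=
      TensorProduct.ext' fun x a => by simp
    have h_apply : LinearMap.rTensor H ι (ρX v) = ρY (ι v) := congr($hρ v)
    refine congr($h_nat (ρX v)).trans ?_
    simpa only [LinearMap.comp_apply, LinearEquiv.coe_coe, h_apply] using h.1 (ι v)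
  · apply Module.Flat.rTensor_preserves_injective_linearMap (M := H) _
      (Module.Flat.rTensor_preserves_injective_linearMap (M := H) _ hι)
    have h_nat : LinearMap.rTensor H (LinearMap.rTensor H ι) ∘ₗ
        (TensorProduct.assoc k X H H).symm.toLinearMap ∘ₗ
        LinearMap.lTensor X (Coalgebra.comul (R := k) (A := H)) =
        (TensorProduct.assoc k Y H H).symm.toLinearMap ∘ₗ
          LinearMap.lTensor Y (Coalgebra.comul (R := k) (A := H)) ∘ₗ LinearMap.rTensor H ι := by
      refine TensorProduct.ext' fun x a => ?_
      simp only [LinearMap.comp_apply, LinearMap.rTensor_tmul, LinearMap.lTensor_tmul]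
      induction Coalgebra.comul (R := k) a with
      | zero => simp
      | tmul b c => simp
      | add s t hs ht => simp only [TensorProduct.tmul_add, map_add, hs, ht]
    have h_apply : LinearMap.rTensor H ι (ρX v) = ρY (ι v) := congr($hρ v)
    refine Eq.trans ?_ congr($h_nat (ρX v)).symm
    rw [← LinearMap.rTensor_comp_apply, hρ, LinearMap.rTensor_comp_apply, h_apply]
    simpa only [LinearMap.comp_apply, LinearEquiv.coe_coe, h_apply] using h.2 (ι v)

lemma IsCrossedPair.of_injective {π : P →ₐc[k] H}
    {coactB : (qhsAlg π) →ₗ[k] P ⊗[k] (qhsAlg π)} (hι : Function.Injective ι)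
    {ractX : X ⊗[k] (qhsAlg π) →ₗ[k] X} {ractY : Y ⊗[k] (qhsAlg π) →ₗ[k] Y}
    (hact : ∀ x b, ι (ractX (x ⊗ₜ b)) = ractY (ι x ⊗ₜ b))
    {ρX : X →ₗ[k] X ⊗[k] H} {ρY : Y →ₗ[k] Y ⊗[k] H}
    (hρ : LinearMap.rTensor H ι ∘ₗ ρX = ρY ∘ₗ ι) (h : IsCrossedPair π coactB ractY ρY) :
    IsCrossedPair π coactB ractX ρX := by
  refine TensorProduct.ext' fun x b => ?_
  apply Module.Flat.rTensor_preserves_injective_linearMap (M := H) _ hι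
  have h_apply (v : X) : LinearMap.rTensor H ι (ρX v) = ρY (ι v) := congr($hρ v)
  refine Eq.trans ?_ (congr($h (ι x ⊗ₜ b)).trans ?_)
  · simp only [LinearMap.comp_apply, LinearMap.rTensor_tmul, ← h_apply]
    induction ρX x with
    | zero => simp
    | tmul z a => simp [hact]
    | add s t hs ht => simp only [TensorProduct.add_tmul, map_add, hs, ht]
  · simp only [LinearMap.comp_apply, LinearMap.lTensor_tmul]
    induction coactB b with
    | zero => simp
    | add s t hs ht => simp only [TensorProduct.tmul_add, map_add, hs, ht]
    | tmul p c =>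
      simp only [LinearEquiv.coe_coe, TensorProduct.leftComm_tmul, TensorProduct.map_tmul,
        LinearMap.comp_apply, ← hact, ← h_apply]
      induction ρX (ractX (x ⊗ₜ c)) with
      | zero => simp
      | tmul z a => simp
      | add s t hs ht => simp only [TensorProduct.tmul_add, map_add, hs, ht]

end Restrict

/-- For a `(P,P,H,B)`-Hopf module `Y`, the left coinvariant
subspace `ᴾY` with the inherited right `H`-coaction and the twisted `B`-action
`y ⋄ b = S(b₁) ▷ y ◁ b₂` is a crossed `(H,B)`-module. -/
theorem leftCoinv_crossedMod (π : P →ₐc[k] H) (hπ : Function.Surjective π)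
    (coactB : (qhsAlg π) →ₗ[k] P ⊗[k] (qhsAlg π))
    (hco : IsRestrictedComul π coactB)
    {Y : Type} [AddCommGroup Y] [Module k Y] (D : PPHBStr π coactB Y) :
    (∀ y ∈ leftCoinv D.lam, ∀ b : qhsAlg π,
      twistRact π coactB D.lact D.ract (y ⊗ₜ b) ∈ leftCoinv D.lam) ∧
    (∀ y ∈ leftCoinv D.lam,
      D.ρ y ∈ LinearMap.range (LinearMap.rTensor H (leftCoinv D.lam).subtype)) ∧
    (∃ (ract' : (leftCoinv D.lam) ⊗[k] (qhsAlg π) →ₗ[k] (leftCoinv D.lam))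
        (ρ' : (leftCoinv D.lam) →ₗ[k] (leftCoinv D.lam) ⊗[k] H),
      (∀ (y : leftCoinv D.lam) (b : qhsAlg π),
        (ract' (y ⊗ₜ b) : Y) = twistRact π coactB D.lact D.ract ((y : Y) ⊗ₜ b)) ∧
      (∀ y : leftCoinv D.lam,
        (LinearMap.rTensor H (leftCoinv D.lam).subtype) (ρ' y) = D.ρ (y : Y)) ∧
      IsRightAction ract' ∧ IsRightCoaction ρ' ∧ IsCrossedPair π coactB ract' ρ') := by
  have h_act : ∀ y ∈ leftCoinv D.lam, ∀ b : qhsAlg π,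
      twistRact π coactB D.lact D.ract (y ⊗ₜ b) ∈ leftCoinv D.lam := fun y hy b =>
    mem_leftCoinv.2 (D.lam_antipodeSandwich hco (mem_leftCoinv.1 hy) b)
  have h_coact : ∀ y ∈ leftCoinv D.lam,
      D.ρ y ∈ LinearMap.range (LinearMap.rTensor H (leftCoinv D.lam).subtype) := fun y hy =>
    (Module.Flat.rTensor_exact H (LinearMap.exact_subtype_ker_map
      (D.lam - TensorProduct.mk k P Y 1)) (D.ρ y)).1
      (D.rTensor_sub_ρ_eq_zero (mem_leftCoinv.1 hy))
  refine ⟨h_act, h_coact, ?_⟩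
  have hι : Function.Injective (leftCoinv D.lam).subtype := (leftCoinv D.lam).injective_subtype
  obtain ⟨g, hg⟩ := LinearMap.exists_leftInverse_of_injective
    (LinearMap.rTensor H (leftCoinv D.lam).subtype)
    (LinearMap.ker_eq_bot.2 (Module.Flat.rTensor_preserves_injective_linearMap (M := H) _ hι))
  let ract' : (leftCoinv D.lam) ⊗[k] (qhsAlg π) →ₗ[k] (leftCoinv D.lam) :=
    (twistRact π coactB D.lact D.ract ∘ₗ
      LinearMap.rTensor (qhsAlg π) (leftCoinv D.lam).subtype).codRestrict (leftCoinv D.lam)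
      fun t => by
        induction t with
        | zero => simp
        | tmul y b => exact h_act y y.2 b
        | add s t hs ht => simpa only [map_add] using add_mem hs ht
  have hract (y : leftCoinv D.lam) (b : qhsAlg π) : (leftCoinv D.lam).subtype (ract' (y ⊗ₜ b)) =
      twistRact π coactB D.lact D.ract ((leftCoinv D.lam).subtype y ⊗ₜ b) := rfl
  have hρ : LinearMap.rTensor H (leftCoinv D.lam).subtype ∘ₗ
      (g ∘ₗ D.ρ ∘ₗ (leftCoinv D.lam).subtype) = D.ρ ∘ₗ (leftCoinv D.lam).subtype := by
    ext1 y
    obtain ⟨z, hz⟩ := h_coact y y.2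
    have hgz : g (LinearMap.rTensor H (leftCoinv D.lam).subtype z) = z := congr($hg z)
    simp only [LinearMap.comp_apply, Submodule.subtype_apply, ← hz, hgz]
  exact ⟨ract', g ∘ₗ D.ρ ∘ₗ (leftCoinv D.lam).subtype, hract, fun y => congr($hρ y),
    (D.isRightAction_twistRact hco).of_injective hι hract, D.ρ_coaction.of_injective hι hρ,
    (D.isCrossedPair_twistRact hco).of_injective hι hract hρ⟩
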